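/- Let K be a field, n a natural number, and P a nonzero prime ideal of the polynomial ring K[x₁,…,xₙ]. Then the Krull dimension of the quotient ring K[x₁,…,xₙ]/P is strictly less than n. -/

import Mathlib

/-- If `P` is a nonzero prime ideal of `K[x₁,…,xₙ]`, then the Krull dimension of
the quotient `K[x₁,…,xₙ]/P` is strictly less than `n`. -/
theorem ringKrullDim_quotient_lt (K : Type*) [Field K] (n : ℕ)
    (P : Ideal (MvPolynomial (Fin n) K)) (hP : P.IsPrime) (hne : P ≠ ⊥) :
    ringKrullDim (MvPolynomial (Fin n) K ⧸ P) < (n : WithBot ℕ∞) := by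
  obtain ⟨r, hrP, hr⟩ := Submodule.exists_mem_ne_zero_of_ne_bot hne
  have hdim : ringKrullDim (MvPolynomial (Fin n) K ⧸ P) + 1 ≤ (n : WithBot ℕ∞) := by
    have h := ringKrullDim_succ_le_of_surjective (Ideal.Quotient.mk P)
      Ideal.Quotient.mk_surjective (mem_nonZeroDivisors_of_ne_zero hr)
      (Ideal.Quotient.eq_zero_iff_mem.mpr hrP)
    simpa [MvPolynomial.ringKrullDim_of_isNoetherianRing] using h
  contrapose! hdim
  calc (n : WithBot ℕ∞) < n + 1 := mod_cast n.lt_succ_self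
    _ ≤ _ := by gcongr
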